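/- (Corollary to Theorem 3.4.) Let 𝒳 ⊆ ℝ be nonempty. Suppose each of the functions f_1, …, f_p : ℝ → ℝ is monotone decreasing on 𝒳 and f_j(x) ≥ 0 for all x ∈ 𝒳 and all j. Then for every λ > 0 and every choice of weights w_1, …, w_p ≥ 0 with ∑_{i=1}^p w_i = 1, the GOWA robust objective function φ is monotone decreasing on 𝒳. -/

import Mathlib

/- The `i`-th largest element (0-indexed) of a multiset of reals, counted with
multiplicity; junk value `0` if `i` is out of range. -/
open Classical in
noncomputable def orderStatM (s : Multiset ℝ) (i : ℕ) : ℝ :=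
  (s.sort (· ≤ ·)).getD (Multiset.card s - 1 - i) 0

/-- `orderStat v i` is the `i`-th largest value (0-indexed) among `v 0, …, v (p-1)`,
counted with multiplicity; it is the order statistic `s_{i+1}` of the paper, so that
`orderStat v 0 ≥ orderStat v 1 ≥ ⋯ ≥ orderStat v (p-1)`. -/
noncomputable def orderStat {p : ℕ} (v : Fin p → ℝ) (i : Fin p) : ℝ :=
  orderStatM (Finset.univ.val.map v) i.val

/-- The GOWA aggregation `φ` applied to the values `v j = f_j(x)`:
`φ = (∑ i, w i * (s_i)^λ)^(1/λ)` (real powers). -/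
noncomputable def gowa {p : ℕ} (w : Fin p → ℝ) (lam : ℝ) (v : Fin p → ℝ) : ℝ :=
  (∑ i : Fin p, w i * (orderStat v i) ^ lam) ^ (1 / lam)

/-- The sorted list of the values of a tuple is the list of its sorted rearrangement. -/
theorem sort_map_univ_eq_ofFn {p : ℕ} (v : Fin p → ℝ) :
    (Finset.univ.val.map v).sort (· ≤ ·) = List.ofFn (v ∘ Tuple.sort v) := by
  have h : Finset.univ.val.map v = (List.ofFn (v ∘ Tuple.sort v) : Multiset ℝ) := by
    rw [Fin.univ_val_map, Multiset.coe_eq_coe]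
    exact (Equiv.Perm.ofFn_comp_perm (Tuple.sort v) v).symm
  rw [h]
  refine List.Perm.eq_of_pairwise' (Multiset.pairwise_sort _ _)
    (List.pairwise_ofFn.2 fun i j hij => Tuple.monotone_sort v hij.le) ?_
  rw [← Multiset.coe_eq_coe, Multiset.sort_eq]

theorem orderStat_eq_sort_rev {p : ℕ} (v : Fin p → ℝ) (i : Fin p) :
    orderStat v i = v (Tuple.sort v i.rev) := by
  have hi : p - 1 - i < p := by omega
  have hrev : (⟨p - 1 - i, hi⟩ : Fin p) = i.rev := by
    ext
    simp only [Fin.val_rev]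
    omega
  unfold orderStat orderStatM
  rw [sort_map_univ_eq_ofFn]
  simp [List.getD_eq_getElem?_getD, hi, hrev]

/-- Sorting tuples is monotone for the pointwise order. -/
theorem Tuple.comp_sort_le_comp_sort {p : ℕ} {α : Type*} [LinearOrder α] {u v : Fin p → α}
    (h : u ≤ v) : u ∘ Tuple.sort u ≤ v ∘ Tuple.sort v := by
  intro i
  by_contra! hlt
  have hmem : Set.MapsTo (fun j => (Tuple.sort u).symm (Tuple.sort v j))
      (Finset.Iic i : Finset (Fin p)) (Finset.Iio i : Finset (Fin p)) := by
    intro j hj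
    simp only [Finset.coe_Iic, Set.mem_Iic, Finset.coe_Iio, Set.mem_Iio] at hj ⊢
    by_contra! hij
    have h1 := Tuple.monotone_sort u hij
    have h2 := Tuple.monotone_sort v hj
    have h3 := h (Tuple.sort v j)
    simp only [Function.comp_apply, Equiv.apply_symm_apply] at h1 h2 hlt
    exact absurd (h1.trans (h3.trans h2)) hlt.not_ge
  have hcard := Finset.card_le_card_of_injOn _ hmem
    ((Tuple.sort v).trans (Tuple.sort u).symm).injective.injOn
  simp at hcard

theorem orderStat_mono {p : ℕ} {u v : Fin p → ℝ} (h : u ≤ v) (i : Fin p) :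
    orderStat u i ≤ orderStat v i := by
  rw [orderStat_eq_sort_rev, orderStat_eq_sort_rev]
  exact Tuple.comp_sort_le_comp_sort h i.rev

theorem orderStat_nonneg {p : ℕ} {v : Fin p → ℝ} (h : 0 ≤ v) (i : Fin p) :
    0 ≤ orderStat v i := by
  rw [orderStat_eq_sort_rev]
  exact h _

theorem gowa_le_gowa {p : ℕ} {w : Fin p → ℝ} (hw : 0 ≤ w) {lam : ℝ} (hlam : 0 ≤ lam)
    {u v : Fin p → ℝ} (hu : 0 ≤ u) (h : u ≤ v) : gowa w lam u ≤ gowa w lam v := by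
  refine Real.rpow_le_rpow (Finset.sum_nonneg fun i _ => mul_nonneg (hw i)
    (Real.rpow_nonneg (orderStat_nonneg hu i) _)) (Finset.sum_le_sum fun i _ => ?_)
    (by positivity)
  exact mul_le_mul_of_nonneg_left
    (Real.rpow_le_rpow (orderStat_nonneg hu i) (orderStat_mono h i) hlam) (hw i)

/-- Corollary to Theorem 3.4: if every scenario objective is monotone decreasing on
`𝒳 ⊆ ℝ` (and nonnegative there), then the GOWA robust objective `φ` is monotone
decreasing on `𝒳`. -/
theorem gowa_antitoneOn {p : ℕ} (hp : 1 ≤ p)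
    (f : Fin p → ℝ → ℝ) (X : Set ℝ) (hX : X.Nonempty)
    (hf : ∀ j, AntitoneOn (f j) X)
    (hf0 : ∀ j, ∀ x ∈ X, 0 ≤ f j x)
    (lam : ℝ) (hlam : 0 < lam)
    (w : Fin p → ℝ) (hw : ∀ i, 0 ≤ w i) (hw1 : ∑ i, w i = 1) :
    AntitoneOn (fun x => gowa w lam (fun j => f j x)) X := by
  intro x hx y hy hxy
  exact gowa_le_gowa hw hlam.le (fun j => hf0 j y hy) (fun j => hf j hx hy hxy)
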